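/- Let p be an odd prime satisfying one of the following conditions: (a) p = 2^m + 1 for some integer m ≥ 1 (p is a Fermat prime); (b) p = 2·q^n + 1 with q an odd prime and n ≥ 1; (c) p = 2·q^n·r^m + 1 with q and r distinct odd primes and n, m ≥ 1. Then there exists an irreducible λ-quiddity over ℤ/pℤ of size at least 3·(p−1)/2. -/

import Mathlib

namespace Quiddity

variable {A : Type*} [CommRing A]

/-- `mMat [a₁, …, aₙ]` is the matrix product `[[aₙ,-1],[1,0]] ⋯ [[a₁,-1],[1,0]]`. -/
def mMat : List A → Matrix (Fin 2) (Fin 2) A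
  | [] => 1
  | a :: t => mMat t * !![a, -1; 1, 0]

/-- Continuant: `cont [] = K₀ = 1`, `cont [a] = K₁(a) = a`, and the continuant recursion. -/
def cont : List A → A
  | [] => 1
  | [a] => a
  | a :: b :: t => a * cont (b :: t) - cont t

/-- A λ-quiddity is a tuple with `Mₙ(a₁,…,aₙ) = ± Id`. -/
def IsQuiddity (l : List A) : Prop := mMat l = 1 ∨ mMat l = -1

/-- The sum `⊕` of two tuples (meaningful for tuples of length ≥ 2):
`(a₁,…,aₘ) ⊕ (b₁,…,b_l) = (a₁+b_l, a₂,…,a_{m−1}, aₘ+b₁, b₂,…,b_{l−1})`. -/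
def oplus (la lb : List A) : List A :=
  (la.headD 0 + lb.getLastD 0) ::
    (la.tail.dropLast ++ (la.getLastD 0 + lb.headD 0) :: lb.tail.dropLast)

/-- Two tuples are equivalent if one is a cyclic permutation of the other or of its
reversal. -/
def TupleEquiv (l l' : List A) : Prop :=
  List.IsRotated l l' ∨ List.IsRotated l.reverse l'

/-- A λ-quiddity `c` is reducible if `c ∼ a ⊕ b` with `b` a λ-quiddity and both of size ≥ 3. -/
def QuiddityReducible (c : List A) : Prop :=
  ∃ a b : List A, 3 ≤ a.length ∧ 3 ≤ b.length ∧ IsQuiddity b ∧ TupleEquiv c (oplus a b)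

/-- `(a, b, a, b, …, a, b)` with `k` repetitions of the pair `(a, b)` (size `2k`). -/
def dynList : ℕ → A → A → List A
  | 0, _, _ => []
  | k + 1, a, b => a :: b :: dynList k a b

/-- `(u, v, v, u, v, v, …, u, v, v)` with `k` repetitions of the block `(u, v, v)`
(size `3k`). -/
def triList : ℕ → A → A → List A
  | 0, _, _ => []
  | k + 1, a, b => a :: b :: b :: triList k a b

end Quiddity

open Quiddity

namespace Quiddity

section Lists

variable {A : Type*}

theorem length_triList (k : ℕ) (u v : A) : (triList k u v).length = 3 * k := by
  induction k with
  | zero => rfl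
  | succ k ih => simp [triList, ih]; ring

theorem triList_add (m n : ℕ) (u v : A) :
    triList (m + n) u v = triList m u v ++ triList n u v := by
  induction m with
  | zero => simp [triList]
  | succ m ih => simp [Nat.succ_add, triList, ih]

theorem triList_succ_eq_reverse (k : ℕ) (u v : A) :
    triList (k + 1) u v = [u] ++ (triList k u v).reverse ++ [v, v] := by
  induction k with
  | zero => simp [triList]
  | succ k ih =>
    rw [triList_add k 1, List.reverse_append, triList, ih]
    simp [triList]

/-- A prefix of `(u, v, v, …, u, v, v)` consists of complete blocks and a proper prefix of one. -/
theorem exists_of_prefix_triList {k : ℕ} {u v : A} {x : List A} (h : x <+: triList k u v) :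
    ∃ j s, x = triList j u v ++ s ∧ (s = [] ∨ s = [u] ∨ s = [u, v]) := by
  induction k generalizing x with
  | zero => exact ⟨0, [], by simpa [triList] using h, by simp⟩
  | succ k ih =>
    match x, h with
    | [], _ => exact ⟨0, [], rfl, by simp⟩
    | [a], h =>
      simp only [triList, List.cons_prefix_cons] at h
      exact ⟨0, [u], by simp [triList, h.1], by simp⟩
    | [a, b], h =>
      simp only [triList, List.cons_prefix_cons] at h
      exact ⟨0, [u, v], by simp [triList, h.1, h.2.1], by simp⟩
    | a :: b :: c :: x, h =>
      simp only [triList, List.cons_prefix_cons] at h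
      obtain ⟨j, s, rfl, hs⟩ := ih h.2.2.2
      exact ⟨j + 1, s, by simp [triList, h.1, h.2.1, h.2.2.1], hs⟩

/-- A suffix of `(u, v, v, …, u, v, v)` consists of a proper suffix of one block and complete
blocks. -/
theorem exists_of_suffix_triList {k : ℕ} {u v : A} {x : List A} (h : x <:+ triList k u v) :
    ∃ j t, x = t ++ triList j u v ∧ (t = [] ∨ t = [v] ∨ t = [v, v]) := by
  induction k with
  | zero => exact ⟨0, [], by simpa [triList] using h, by simp⟩
  | succ k ih =>
    simp only [triList, List.suffix_cons_iff] at h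
    rcases h with rfl | rfl | rfl | h
    · exact ⟨k + 1, [], rfl, by simp⟩
    · exact ⟨k, [v, v], rfl, by simp⟩
    · exact ⟨k, [v], rfl, by simp⟩
    · exact ih h

theorem exists_of_infix_triList {k : ℕ} {u v : A} {x : List A} (h : x <:+: triList k u v) :
    ∃ j t s, x = t ++ triList j u v ++ s ∧ (t = [] ∨ t = [v] ∨ t = [v, v]) ∧
      (s = [] ∨ s = [u] ∨ s = [u, v]) := by
  obtain ⟨y, hxy, hy⟩ := List.infix_iff_prefix_suffix.1 h
  obtain ⟨j, t, rfl, ht⟩ := exists_of_suffix_triList hy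
  have hz : x <+: t ∨ ∃ z, x = t ++ z ∧ z <+: triList j u v := by
    rcases List.prefix_or_prefix_of_prefix hxy (List.prefix_append t _) with h | ⟨z, rfl⟩
    · exact .inl h
    · exact .inr ⟨z, rfl, (List.prefix_append_right_inj t).1 hxy⟩
  rcases hz with h | ⟨z, rfl, hz⟩
  · refine ⟨0, x, [], by simp [triList], ?_, by simp⟩
    rcases ht with rfl | rfl | rfl <;> simp_all [List.prefix_cons_iff] <;> grind
  · obtain ⟨i, s, rfl, hs⟩ := exists_of_prefix_triList hz
    exact ⟨i, t, s, by simp, ht, hs⟩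

theorem infix_append_self_of_isRotated {l l' : List A} (h : l ~r l') :
    l' <:+: l ++ l := by
  obtain ⟨n, hn, rfl⟩ := List.isRotated_iff_mod.1 h
  rw [List.rotate_eq_drop_append_take hn]
  exact ⟨l.take n, l.drop n, by
    rw [← List.append_assoc, List.take_append_drop, List.append_assoc, List.take_append_drop]⟩

theorem TupleEquiv.infix_triList {k : ℕ} {u v : A} {l : List A}
    (h : TupleEquiv (triList k u v) l) : l <:+: triList (2 * k + 1) u v := by
  rcases h with h | h
  · refine (infix_append_self_of_isRotated h).trans ?_
    rw [← triList_add, ← two_mul, triList_add (2 * k)]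
    exact (List.prefix_append _ _).isInfix
  · refine (infix_append_self_of_isRotated h).trans ?_
    rw [← List.reverse_append, ← triList_add, ← two_mul, triList_succ_eq_reverse]
    exact List.infix_append _ _ _

variable [CommRing A]

theorem mMat_append (s t : List A) : mMat (s ++ t) = mMat t * mMat s := by
  induction s with
  | nil => simp [mMat]
  | cons a s ih => simp [mMat, ih, Matrix.mul_assoc]

/-- In a reducible tuple some cyclic block, omitting at least three entries, has continuant `± 1`. -/
theorem QuiddityReducible.exists_suffix {c : List A} (h : QuiddityReducible c) :
    ∃ l x : List A, TupleEquiv c l ∧ x <:+ l ∧ 1 ≤ x.length ∧ x.length + 3 ≤ c.length ∧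
      (mMat x 0 0 = 1 ∨ mMat x 0 0 = -1) := by
  obtain ⟨a, b, ha, hb, hq, he⟩ := h
  have hlen : c.length = (oplus a b).length := by
    rcases he with he | he
    · exact he.perm.length_eq
    · simpa using he.perm.length_eq
  refine ⟨_, b.tail.dropLast, he, ?_, ?_, ?_, ?_⟩
  · exact ((List.suffix_cons _ _).trans (List.suffix_append _ _)).trans (List.suffix_cons _ _)
  · simp; omega
  · rw [hlen]; simp [oplus]; omega
  · obtain ⟨b₁, y, rfl⟩ := List.exists_cons_of_length_pos (l := b) (by omega)
    obtain rfl | ⟨x, z, rfl⟩ := List.eq_nil_or_concat y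
    · simp at hb
    · have key : mMat x 0 0 = -(mMat (b₁ :: (x ++ [z])) 1 1) := by
        simp [mMat, mMat_append, Matrix.mul_apply, Matrix.vecMul, dotProduct, Fin.sum_univ_two]
      simp only [List.tail_cons, List.concat_eq_append, List.dropLast_concat] at hq ⊢
      rcases hq with hq | hq <;> simp [key, hq]

theorem mMat_triList {u v : A} (huv : u * v = 1) (k : ℕ) :
    mMat (triList k u v) = (-1 : A) ^ k • !![u ^ k, v * (v ^ k - u ^ k); 0, v ^ k] := by
  induction k with
  | zero => simp [triList, mMat, Matrix.one_fin_two]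
  | succ k ih =>
    simp only [triList, mMat, ih]
    ext i j
    fin_cases i <;> fin_cases j <;>
      simp [Matrix.mul_apply, Fin.sum_univ_two, pow_succ] <;> grind

/-- The squared continuants of the blocks occurring in `(u, v, v, u, v, v, …)` when `u * v = 1`. -/
theorem mMat_sq_of_infix_triList {u v : A} (huv : u * v = 1) {k n : ℕ} {x : List A}
    (h : x <:+: triList n u v) (hx : 1 ≤ x.length) (hk : x.length + 3 ≤ 3 * k) :
    mMat x 0 0 = 0 ∨ (∃ i, 1 ≤ i ∧ i < k ∧
      (mMat x 0 0 ^ 2 = (v ^ 2) ^ i ∨ mMat x 0 0 ^ 2 = (u ^ 2) ^ i)) ∨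
      ∃ i, mMat x 0 0 ^ 2 = (v * (v ^ i - u ^ i)) ^ 2 := by
  obtain ⟨j, t, s, rfl, ht, hs⟩ := exists_of_infix_triList h
  simp only [List.length_append, length_triList] at hx hk
  have he : ((-1 : A) ^ j) ^ 2 = 1 := by rw [← pow_mul, mul_comm, pow_mul]; simp
  have hj : u ^ j * v ^ j = 1 := by rw [← mul_pow, huv, one_pow]
  rw [mMat_append, mMat_append, mMat_triList huv]
  have hpow (a : A) (i : ℕ) : (a ^ 2) ^ i = (a ^ i) ^ 2 := by ring
  simp only [hpow]
  rcases ht with rfl | rfl | rfl <;> rcases hs with rfl | rfl | rfl <;>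
    simp only [List.length_nil, List.length_cons] at hx hk
  · exact .inr (.inl ⟨j, by omega, by omega, .inr (by simp [mMat]; grind)⟩)
  · exact .inr (.inl ⟨j + 1, by omega, by omega, .inr (by
      simp [mMat, Matrix.mul_apply, Fin.sum_univ_two]; grind)⟩)
  · exact .inl (by simp [mMat, Matrix.mul_apply, Fin.sum_univ_two]; grind)
  · exact .inr (.inl ⟨j + 1, by omega, by omega, .inl (by
      simp [mMat, Matrix.mul_apply, Fin.sum_univ_two]; grind)⟩)
  · exact .inl (by simp [mMat, Matrix.mul_apply, Fin.sum_univ_two]; grind)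
  · exact .inr (.inl ⟨j + 1, by omega, by omega, .inl (by
      simp [mMat, Matrix.mul_apply, Fin.sum_univ_two]; grind)⟩)
  · exact .inr (.inr ⟨j + 1, by simp [mMat, Matrix.mul_apply, Fin.sum_univ_two]; grind⟩)
  · exact .inr (.inl ⟨j + 1, by omega, by omega, .inr (by
      simp [mMat, Matrix.mul_apply, Fin.sum_univ_two]; grind)⟩)
  · exact .inr (.inl ⟨j + 2, by omega, by omega, .inl (by
      simp [mMat, Matrix.mul_apply, Fin.sum_univ_two]; grind)⟩)

end Lists

theorem isQuiddity_triList {F : Type*} [Field F] {u v : F} (huv : u * v = 1) :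
    IsQuiddity (triList (orderOf (v ^ 2)) u v) := by
  set k := orderOf (v ^ 2)
  have hv : v ^ k = 1 ∨ v ^ k = -1 := by
    rw [← mul_self_eq_one_iff, ← mul_pow, ← sq]
    exact pow_orderOf_eq_one _
  have hu : u ^ k = v ^ k := by
    have h : u ^ k * v ^ k = 1 := by rw [← mul_pow, huv, one_pow]
    rcases hv with hv | hv <;> grind
  rw [IsQuiddity, mMat_triList huv, hu, sub_self, mul_zero]
  rcases hv with hv | hv <;> rcases neg_one_pow_eq_or F k with hk | hk <;>
    simp [hv, hk, Matrix.one_fin_two]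

theorem not_quiddityReducible_triList {F : Type*} [Field F] {u v : F} (huv : u * v = 1)
    (hsq : ¬ IsSquare (1 + 4 * v ^ 2)) :
    ¬ QuiddityReducible (triList (orderOf (v ^ 2)) u v) := by
  intro h
  obtain ⟨l, x, hl, hxl, hx₁, hx₂, hx⟩ := h.exists_suffix
  rw [length_triList] at hx₂
  have hsqx : mMat x 0 0 ^ 2 = 1 := by rcases hx with hx | hx <;> simp [hx]
  have hu : u ^ 2 = (v ^ 2)⁻¹ := by
    rw [eq_inv_of_mul_eq_one_left huv, inv_pow]
  rcases mMat_sq_of_infix_triList huv (hxl.isInfix.trans hl.infix_triList) hx₁ hx₂ with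
    h | ⟨i, hi₁, hi₂, h | h⟩ | ⟨i, h⟩
  · simp [h] at hsqx
  · exact pow_ne_one_of_lt_orderOf (by omega) hi₂ (h.symm.trans hsqx)
  · rw [hsqx, hu, inv_pow, eq_comm, inv_eq_one] at h
    exact pow_ne_one_of_lt_orderOf (by omega) hi₂ h
  · have hi : u ^ i * v ^ i = 1 := by rw [← mul_pow, huv, one_pow]
    exact hsq ⟨v * (v ^ i + u ^ i), by grind⟩

section Counting

variable {p : ℕ} [Fact p.Prime]

theorem one_add_four_mul_sq_ne_zero (hodd : Odd p) {v : ZMod p} (hv : v ≠ 0)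
    (hord : orderOf (v ^ 2) = (p - 1) / 2) : 1 + 4 * v ^ 2 ≠ 0 := by
  intro h0
  have hI : (2 * v) ^ 2 = -1 := by linear_combination h0
  have h4 := ZMod.mod_four_ne_three_of_sq_eq_neg_one hI
  have hp := (Fact.out : p.Prime).two_le
  obtain ⟨l, hl⟩ : ∃ l, p - 1 = 4 * l := ⟨(p - 1) / 4, by have := Nat.odd_iff.1 hodd; omega⟩
  have hc : v ^ 2 * (1 + 2 * v) ^ 4 = 1 := by grind
  have hc0 : 1 + 2 * v ≠ 0 := by rintro h; simp [h] at hc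
  have hl1 : (v ^ 2) ^ l = 1 := by
    have := congr_arg (· ^ l) hc
    simp only [mul_pow _ _ l, one_pow, ← pow_mul (1 + 2 * v), ← hl] at this
    rwa [ZMod.pow_card_sub_one_eq_one hc0, mul_one] at this
  have := orderOf_dvd_of_pow_eq_one hl1
  have := Nat.le_of_dvd (by omega) this
  omega

theorem exists_orderOf_sq_and_not_isSquare (hodd : Odd p)
    (hφ : (p - 1) / 2 ≤ 2 * ((p - 1) / 2).totient) :
    ∃ v : ZMod p, v ≠ 0 ∧ orderOf (v ^ 2) = (p - 1) / 2 ∧ ¬ IsSquare (1 + 4 * v ^ 2) := by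
  by_contra! hcon
  have hp2 := (Fact.out : p.Prime).two_le
  have hmod := Nat.odd_iff.1 hodd
  have hpos : 0 < (p - 1) / 2 := by omega
  have h2 : (2 : ZMod p) ≠ 0 := by
    refine Ring.two_ne_zero ?_
    rw [ZMod.ringChar_zmod_n]
    omega
  have h4 : (4 : ZMod p) ≠ 0 := by
    have : (4 : ZMod p) = 2 * 2 := by norm_num
    simp [this, h2]
  set G : Finset (ZMod p) := {w | orderOf w = (p - 1) / 2} with hG
  set T : Finset (ZMod p) := {0, 1, -1}ᶜ with hT
  have hGcard : G.card = ((p - 1) / 2).totient := by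
    rw [← IsCyclic.card_orderOf_eq_totient (α := (ZMod p)ˣ)
      (by rw [ZMod.card_units]; exact Nat.div_dvd_of_dvd (by omega))]
    symm
    refine Finset.card_bij (fun a _ => (a : ZMod p)) ?_ ?_ ?_
    · intro a ha
      simpa [hG, orderOf_units] using ha
    · intro a _ b _ h
      exact Units.ext h
    · intro w hw
      have hw : orderOf w = (p - 1) / 2 := by simpa [hG] using hw
      have hu : IsUnit w := (orderOf_pos_iff.1 (by omega)).isUnit
      obtain ⟨a, rfl⟩ := hu
      exact ⟨a, by simpa [orderOf_units] using hw, rfl⟩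
  have hTcard : T.card = p - 3 := by
    rw [hT, Finset.card_compl, ZMod.card,
      Finset.card_eq_three.2 ⟨0, 1, -1, by simp, by simp, ?_, rfl⟩]
    intro h
    exact h2 (by linear_combination h)
  set f : ZMod p → ZMod p := fun t => ((t - t⁻¹) / 4) ^ 2 with hf
  have hfib : ∀ w ∈ G, 4 ≤ (T.filter (fun t => f t = w)).card := by
    intro w hw
    have hw : orderOf w = (p - 1) / 2 := by simpa [hG] using hw
    have hw0 : w ≠ 0 := by
      rintro rfl
      simp at hw
      omega
    obtain ⟨v, hv⟩ : IsSquare w := by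
      rw [ZMod.euler_criterion p hw0, ← orderOf_dvd_iff_pow_eq_one, hw]
      exact dvd_of_eq (by omega)
    rw [← sq] at hv
    subst hv
    have hv0 : v ≠ 0 := by rintro rfl; simp at hw0
    obtain ⟨s, hs⟩ := hcon v hv0 hw
    have hs0 : s ≠ 0 := by
      rintro rfl
      exact one_add_four_mul_sq_ne_zero hodd hv0 hw (by simpa using hs)
    have hmul : (s + 2 * v) * (s - 2 * v) = 1 := by linear_combination -hs
    have hmem : ∀ a b : ZMod p, a * b = 1 → (a - b) ^ 2 = 16 * v ^ 2 →
        a ∈ T.filter (fun t => f t = v ^ 2) := by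
      intro a b hab hd
      have hb : a⁻¹ = b := inv_eq_of_mul_eq_one_right hab
      have hd0 : a ≠ b := by
        rintro rfl
        have : (2 : ZMod p) ^ 4 * v ^ 2 = 0 := by linear_combination -hd
        simp [h2, hv0] at this
      simp only [hT, hf, Finset.mem_filter, Finset.mem_compl, Finset.mem_insert,
        Finset.mem_singleton, hb]
      refine ⟨?_, ?_⟩
      · rintro (rfl | rfl | rfl)
        · simp at hab
        · exact hd0 (by linear_combination -hab)
        · exact hd0 (by linear_combination hab)
      · field_simp
        linear_combination hd
    have hsub : ({s + 2 * v, s - 2 * v, -(s + 2 * v), -(s - 2 * v)} : Finset (ZMod p)) ⊆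
        T.filter (fun t => f t = v ^ 2) := by
      intro a ha
      simp only [Finset.mem_insert, Finset.mem_singleton] at ha
      rcases ha with rfl | rfl | rfl | rfl
      · exact hmem _ (s - 2 * v) hmul (by ring)
      · exact hmem _ (s + 2 * v) (by linear_combination hmul) (by ring)
      · exact hmem _ (-(s - 2 * v)) (by linear_combination hmul) (by ring)
      · exact hmem _ (-(s + 2 * v)) (by linear_combination hmul) (by ring)
    refine le_trans (le_of_eq ?_) (Finset.card_le_card hsub)
    have h4v : 4 * v ≠ 0 := mul_ne_zero h4 hv0
    have h2s : 2 * s ≠ 0 := mul_ne_zero h2 hs0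
    have h₁ : s + 2 * v ≠ s - 2 * v := fun h => h4v (by linear_combination h)
    have h₂ : s + 2 * v ≠ -(s + 2 * v) := fun h =>
      left_ne_zero_of_mul_eq_one hmul
        ((mul_eq_zero.1 (by linear_combination h)).resolve_left h2)
    have h₃ : s + 2 * v ≠ -(s - 2 * v) := fun h => h2s (by linear_combination h)
    have h₄ : s - 2 * v ≠ -(s + 2 * v) := fun h => h2s (by linear_combination h)
    have h₅ : s - 2 * v ≠ -(s - 2 * v) := fun h =>
      right_ne_zero_of_mul_eq_one hmul
        ((mul_eq_zero.1 (by linear_combination h)).resolve_left h2)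
    have h₆ : -(s + 2 * v) ≠ -(s - 2 * v) := fun h => h₁ (neg_injective h)
    rw [Finset.card_insert_of_notMem, Finset.card_insert_of_notMem, Finset.card_pair h₆]
    · simp only [Finset.mem_insert, Finset.mem_singleton, not_or]
      exact ⟨h₄, h₅⟩
    · simp only [Finset.mem_insert, Finset.mem_singleton, not_or]
      exact ⟨h₁, h₂, h₃⟩
  have hle : G.card * 4 ≤ T.card := by
    have := Finset.card_nsmul_le_sum G (fun w => (T.filter (fun t => f t = w)).card) 4 hfib
    rw [smul_eq_mul] at this
    refine this.trans ?_
    rw [← Finset.card_biUnion]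
    · exact Finset.card_le_card (Finset.biUnion_subset.2 fun w _ => Finset.filter_subset _ _)
    · intro a _ b _ hab
      exact Finset.disjoint_filter.2 fun t _ h₁ h₂ => hab (h₁.symm.trans h₂)
  omega

end Counting

theorem le_two_mul_totient_prime_pow {q n : ℕ} (hq : q.Prime) (hn : 1 ≤ n) :
    q ^ n ≤ 2 * (q ^ n).totient := by
  obtain ⟨n, rfl⟩ := Nat.exists_eq_add_of_le' hn
  rw [Nat.totient_prime_pow_succ hq, pow_succ, mul_left_comm]
  have := hq.two_le
  exact Nat.mul_le_mul_left _ (by omega)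

theorem le_two_mul_totient_prime_pow_mul {q r n m : ℕ} (hq : q.Prime) (hr : r.Prime) (hq' : Odd q)
    (hr' : Odd r) (hqr : q ≠ r) (hn : 1 ≤ n) (hm : 1 ≤ m) :
    q ^ n * r ^ m ≤ 2 * (q ^ n * r ^ m).totient := by
  obtain ⟨n, rfl⟩ := Nat.exists_eq_add_of_le' hn
  obtain ⟨m, rfl⟩ := Nat.exists_eq_add_of_le' hm
  rw [Nat.totient_mul (Nat.Coprime.pow _ _ ((Nat.coprime_primes hq hr).2 hqr)),
    Nat.totient_prime_pow_succ hq, Nat.totient_prime_pow_succ hr]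
  have hq₂ := hq.two_le
  have hr₂ := hr.two_le
  have key : q * r ≤ 2 * ((q - 1) * (r - 1)) := by
    obtain ⟨a, rfl⟩ := hq'
    obtain ⟨b, rfl⟩ := hr'
    simp only [Nat.add_sub_cancel]
    have ha : 1 ≤ a := by omega
    have hb : 1 ≤ b := by omega
    rcases (by omega : a < b ∨ b < a) with h | h <;> nlinarith
  calc q ^ (n + 1) * r ^ (m + 1) = q ^ n * r ^ m * (q * r) := by ring
    _ ≤ q ^ n * r ^ m * (2 * ((q - 1) * (r - 1))) := Nat.mul_le_mul_left _ key
    _ = _ := by ring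

end Quiddity

/-- for odd primes `p` of Fermat type `2^m + 1`, of type `2qⁿ + 1`, or of
type `2qⁿrᵐ + 1`, there is an irreducible λ-quiddity over `ℤ/pℤ` of size ≥ `3(p−1)/2`. -/
theorem stmt16 (p : ℕ) (hp : p.Prime) (hodd : Odd p)
    (h : (∃ m : ℕ, 1 ≤ m ∧ p = 2 ^ m + 1) ∨
         (∃ q n : ℕ, q.Prime ∧ Odd q ∧ 1 ≤ n ∧ p = 2 * q ^ n + 1) ∨
         (∃ q r n m : ℕ, q.Prime ∧ r.Prime ∧ Odd q ∧ Odd r ∧ q ≠ r ∧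
            1 ≤ n ∧ 1 ≤ m ∧ p = 2 * q ^ n * r ^ m + 1)) :
    ∃ l : List (ZMod p), IsQuiddity l ∧ ¬ QuiddityReducible l ∧
      3 * (p - 1) / 2 ≤ l.length := by
  have := Fact.mk hp
  obtain ⟨v, hv, hord, hsq⟩ := exists_orderOf_sq_and_not_isSquare (p := p) hodd (by
    rcases h with ⟨m, hm, rfl⟩ | ⟨q, n, hq, hq', hn, rfl⟩ |
      ⟨q, r, n, m, hq, hr, hq', hr', hqr, hn, hm, rfl⟩
    · obtain ⟨m, rfl⟩ := Nat.exists_eq_add_of_le' hm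
      rw [Nat.add_sub_cancel, pow_succ, Nat.mul_div_cancel _ two_pos]
      rcases m with - | m
      · simp
      · exact le_two_mul_totient_prime_pow Nat.prime_two (by omega)
    · simpa using le_two_mul_totient_prime_pow hq hn
    · rw [Nat.add_sub_cancel, mul_assoc, Nat.mul_div_cancel_left _ two_pos]
      exact le_two_mul_totient_prime_pow_mul hq hr hq' hr' hqr hn hm)
  have huv : v⁻¹ * v = 1 := inv_mul_cancel₀ hv
  refine ⟨triList (orderOf (v ^ 2)) v⁻¹ v, isQuiddity_triList huv,
    not_quiddityReducible_triList huv hsq, ?_⟩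
  rw [length_triList, hord]
  have := Nat.odd_iff.1 hodd
  omega
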